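/- (Closed-form inverse of dexp on SO(3)) For every vector ξ ∈ ℝ³ with 0 < ‖ξ‖ < 2π, the matrix M := I − (1/2)·ξ̂ + (1 − (‖ξ‖/2)·cot(‖ξ‖/2))·(ξ̂²/‖ξ‖²) satisfies M · dexp_ξ = I, where dexp_ξ := I + ((1 − cos‖ξ‖)/‖ξ‖²)·ξ̂ + ((‖ξ‖ − sin‖ξ‖)/‖ξ‖³)·ξ̂² and cot t = cos t / sin t. -/

import Mathlib

open Matrix

/-- The cross-product (skew-symmetric) matrix of a vector `x ∈ ℝ³`,
determined by `hat x *ᵥ y = x ×₃ y`. -/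
def hat (x : Fin 3 → ℝ) : Matrix (Fin 3) (Fin 3) ℝ :=
  !![0, -x 2, x 1; x 2, 0, -x 0; -x 1, x 0, 0]

/-- The Euclidean norm of a vector in `ℝ³`. -/
noncomputable def enorm3 (x : Fin 3 → ℝ) : ℝ :=
  Real.sqrt (x 0 ^ 2 + x 1 ^ 2 + x 2 ^ 2)

/-- The closed form of the right-translated differential of the exponential on SO(3):
`dexp_ξ = I + ((1 − cos‖ξ‖)/‖ξ‖²)·ξ̂ + ((‖ξ‖ − sin‖ξ‖)/‖ξ‖³)·ξ̂²`. -/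
noncomputable def dexpSO3 (ξ : Fin 3 → ℝ) : Matrix (Fin 3) (Fin 3) ℝ :=
  1 + ((1 - Real.cos (enorm3 ξ)) / enorm3 ξ ^ 2) • hat ξ +
    ((enorm3 ξ - Real.sin (enorm3 ξ)) / enorm3 ξ ^ 3) • hat ξ ^ 2

theorem hat_pow_three (x : Fin 3 → ℝ) : hat x ^ 3 = -(enorm3 x ^ 2) • hat x := by
  have h : enorm3 x ^ 2 = x 0 ^ 2 + x 1 ^ 2 + x 2 ^ 2 := Real.sq_sqrt (by positivity)
  rw [h]
  ext i j
  fin_cases i <;> fin_cases j <;>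
    simp [hat, pow_succ, Matrix.mul_apply, Fin.sum_univ_three] <;> ring

/-- Multiplication of quadratic polynomials in an element `K` with `K ^ 3 = -r • K`. -/
theorem quadratic_mul_quadratic_of_pow_three {A : Type*} [Ring A] [Algebra ℝ A] {K : A} {r : ℝ}
    (hK : K ^ 3 = -r • K) (a b c d : ℝ) :
    (1 + a • K + b • K ^ 2) * (1 + c • K + d • K ^ 2) =
      1 + (a + c - r * (a * d + b * c)) • K + (b + d + a * c - r * (b * d)) • K ^ 2 := by
  have h12 : K * K ^ 2 = -r • K := by rw [← pow_succ', hK]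
  have h21 : K ^ 2 * K = -r • K := by rw [← pow_succ, hK]
  have h22 : K ^ 2 * K ^ 2 = -r • K ^ 2 := by
    rw [← pow_add, show 2 + 2 = 3 + 1 from rfl, pow_succ, hK, smul_mul_assoc, ← sq]
  simp only [add_mul, mul_add, one_mul, mul_one, smul_mul_smul_comm, h12, h21, h22, ← sq]
  module

/-- Closed-form inverse of dexp on SO(3): for `0 < ‖ξ‖ < 2π`, the matrix
`M = I − (1/2)·ξ̂ + (1 − (‖ξ‖/2)·cot(‖ξ‖/2))·(ξ̂²/‖ξ‖²)` satisfies `M · dexp_ξ = I`. -/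
theorem dexp_so3_inverse (ξ : Fin 3 → ℝ) (h0 : 0 < enorm3 ξ)
    (h2π : enorm3 ξ < 2 * Real.pi) :
    (1 - (1 / 2 : ℝ) • hat ξ +
        ((1 - (enorm3 ξ / 2) * Real.cot (enorm3 ξ / 2)) / enorm3 ξ ^ 2) • hat ξ ^ 2) *
      dexpSO3 ξ = 1 := by
  have hs : Real.sin (enorm3 ξ / 2) ≠ 0 :=
    (Real.sin_pos_of_pos_of_lt_pi (by linarith) (by linarith)).ne'
  have hK := hat_pow_three ξ
  rw [dexpSO3, sub_eq_add_neg 1 ((1 / 2 : ℝ) • hat ξ), ← neg_smul,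
    quadratic_mul_quadratic_of_pow_three hK, Real.cot_eq_cos_div_sin]
  generalize hat ξ = K
  obtain ⟨h, hh⟩ : ∃ h, enorm3 ξ = 2 * h := ⟨enorm3 ξ / 2, by ring⟩
  rw [hh] at h0 hs ⊢
  rw [mul_div_cancel_left₀ h two_ne_zero] at hs ⊢
  have hpos : h ≠ 0 := by rintro rfl; simp at h0
  have hc : Real.cos h ^ 2 = 1 - Real.sin h ^ 2 := Real.cos_sq' h
  rw [Real.sin_two_mul, Real.cos_two_mul, hc]
  have key (u v : ℝ) (hu : u = 0) (hv : v = 0) : 1 + u • K + v • K ^ 2 = 1 := by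
    simp [hu, hv]
  apply key
  · field_simp
    ring
  · field_simp
    ring_nf
    rw [hc]
    ring
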